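/- arXiv:1703.10477 — 3 statements merged into one kernel-verified Lean document; each statement's English description precedes it below -/
import Mathlib

section
/- Let p be a prime, Λ = Zp[[X]], and let F ∈ Λ be coprime to ω_n = (1+X)^{p^n} − 1 for a given n ≥ 1. Then the quotients Λ/(F, ω_n) and Λ/(F, ω_{n−1}) are finite (Zp-rank zero), and the kernel of the natural projection π_n : Λ/(F, ω_n) → Λ/(F, ω_{n−1}) is finite of order p^{v}, where v = ord_{ε_n} F(ε_n), the p-adic valuation (normalized so ord_{ε_n}(ε_n) = 1) of F evaluated at ε_n = ζ_{p^n} − 1 for a primitive p^n-th root of unity ζ_{p^n}. -/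
open PowerSeries

/-- `ω_n = (1+X)^{p^n} - 1` in `Λ = Zp[[X]]`. -/
noncomputable def omegaPS (p : ℕ) [Fact p.Prime] (n : ℕ) : PowerSeries ℤ_[p] :=
  (1 + PowerSeries.X) ^ p ^ n - 1

/-- The `p^n`-th "cyclotomic" polynomial in `1+X`:
`Φ_n = ω_n/ω_{n-1} = ∑_{j<p} (1+X)^{j·p^{n-1}}`. -/
noncomputable def PhiPS (p : ℕ) [Fact p.Prime] (n : ℕ) : PowerSeries ℤ_[p] :=
  ∑ j ∈ Finset.range p, (1 + PowerSeries.X) ^ (j * p ^ (n - 1))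

theorem aux_ker {R : Type*} [CommRing R] [IsDomain R] (F a b : R) (ha : a ≠ 0)
    (hF : ∀ x, a ∣ x * F → a ∣ x)
    (π : (R ⧸ Ideal.span {F, a * b}) →+* (R ⧸ Ideal.span {F, a}))
    (hπ : ∀ f : R, π (Ideal.Quotient.mk _ f) = Ideal.Quotient.mk _ f) :
    Nat.card (RingHom.ker π) = Nat.card (R ⧸ Ideal.span {F, b}) := by
  let φ : R →ₗ[R] (R ⧸ Ideal.span {F, a * b}) :=
    (Submodule.mkQ (Ideal.span {F, a * b})).comp (LinearMap.mulRight R a)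
  have hφ : ∀ g, φ g = Ideal.Quotient.mk (Ideal.span {F, a * b}) (g * a) := fun g => rfl
  have hk : LinearMap.ker φ = Ideal.span {F, b} := by
    ext g
    rw [LinearMap.mem_ker, hφ, Ideal.Quotient.eq_zero_iff_mem, Ideal.mem_span_pair,
      Ideal.mem_span_pair]
    constructor
    · rintro ⟨c, d, h⟩
      obtain ⟨e, rfl⟩ := hF c ⟨g - d * b, by linear_combination h⟩
      refine ⟨e, d, mul_left_cancel₀ ha ?_⟩
      linear_combination h
    · rintro ⟨c, d, h⟩
      exact ⟨c * a, d, by linear_combination a * h⟩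
  have hr : (LinearMap.range φ : Set (R ⧸ Ideal.span {F, a * b})) = (RingHom.ker π : Set _) := by
    ext y
    obtain ⟨y, rfl⟩ := Ideal.Quotient.mk_surjective y
    simp only [SetLike.mem_coe, LinearMap.mem_range, RingHom.mem_ker, hφ, hπ,
      Ideal.Quotient.eq_zero_iff_mem, Ideal.Quotient.mk_eq_mk_iff_sub_mem]
    constructor
    · rintro ⟨g, h⟩
      rw [Ideal.mem_span_pair] at h ⊢
      obtain ⟨c, d, h⟩ := h
      exact ⟨-c, g - d * b, by linear_combination -h⟩
    · intro h
      rw [Ideal.mem_span_pair] at h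
      obtain ⟨c, d, h⟩ := h
      refine ⟨d, ?_⟩
      rw [Ideal.mem_span_pair]
      exact ⟨-c, 0, by linear_combination -h⟩
  rw [← hk]
  rw [Nat.card_congr (LinearMap.quotKerEquivRange φ).toEquiv]
  exact (Nat.card_congr (Equiv.setCongr hr)).symm

theorem aux_le {R : Type*} [CommRing R] (F a b : R) :
    Ideal.span {F, a * b} ≤ Ideal.span {F, a} := by
  rw [Ideal.span_le]
  rintro x (rfl | rfl)
  · exact Ideal.subset_span (by simp)
  · exact Ideal.mul_mem_right _ _ (Ideal.subset_span (by simp))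

theorem aux_card {R : Type*} [CommRing R] [IsDomain R] (F a b : R) (ha : a ≠ 0)
    (hF : ∀ x, a ∣ x * F → a ∣ x) :
    Nat.card (R ⧸ Ideal.span {F, a * b}) =
      Nat.card (R ⧸ Ideal.span {F, a}) * Nat.card (R ⧸ Ideal.span {F, b}) := by
  let π := Ideal.Quotient.factor (aux_le F a b)
  have h1 := aux_ker F a b ha hF π (fun f => Ideal.Quotient.factor_mk _ _)
  have hs : Function.Surjective π := Ideal.Quotient.factor_surjective _
  rw [← h1]
  have := AddSubgroup.card_eq_card_quotient_mul_card_addSubgroup (π.toAddMonoidHom.ker)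
  have h2 := Nat.card_congr
    (QuotientAddGroup.quotientKerEquivOfSurjective π.toAddMonoidHom hs).toEquiv
  rw [this, h2]
  rfl

section
variable {p : ℕ} [Fact p.Prime]

theorem aux_X (G : PowerSeries ℤ_[p]) (m : ℕ) (u : ℤ_[p]ˣ)
    (h : constantCoeff G = u * (p : ℤ_[p]) ^ m) :
    Nat.card (PowerSeries ℤ_[p] ⧸ Ideal.span {G, X}) = p ^ m := by
  let ψ : PowerSeries ℤ_[p] →+* ZMod (p ^ m) := (PadicInt.toZModPow m).comp constantCoeff
  have hs : Function.Surjective ψ := ZMod.ringHom_surjective ψ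
  have hk : RingHom.ker ψ = Ideal.span {G, X} := by
    ext f
    have : f ∈ RingHom.ker ψ ↔ constantCoeff f ∈ RingHom.ker (PadicInt.toZModPow (p := p) m) :=
      Iff.rfl
    rw [this, PadicInt.ker_toZModPow, Ideal.mem_span_singleton, Ideal.mem_span_pair]
    constructor
    · rintro ⟨c, hc⟩
      have : X ∣ f - C (c * (u⁻¹ : ℤ_[p]ˣ)) * G := by
        rw [X_dvd_iff]
        simp only [map_sub, map_mul, constantCoeff_C, h, hc]
        linear_combination (- c * (p : ℤ_[p]) ^ m) * u.inv_mul
      obtain ⟨d, hd⟩ := this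
      exact ⟨C (c * (u⁻¹ : ℤ_[p]ˣ)), d, by linear_combination -hd⟩
    · rintro ⟨c, d, rfl⟩
      simp only [map_add, map_mul, h, constantCoeff_X]
      exact ⟨constantCoeff c * u, by ring⟩
  rw [← hk, Nat.card_congr (RingHom.quotientKerEquivOfSurjective hs).toEquiv, Nat.card_zmod]

theorem omega_zero : omegaPS p 0 = X := by simp [omegaPS]

theorem omega_succ (n : ℕ) : omegaPS p (n + 1) = omegaPS p n * PhiPS p (n + 1) := by
  have := geom_sum_mul ((1 + X : PowerSeries ℤ_[p]) ^ p ^ n) p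
  simp only [omegaPS, PhiPS, Nat.add_sub_cancel]
  rw [pow_succ, pow_mul, ← this, mul_comm]
  congr 1
  exact Finset.sum_congr rfl fun j _ => by rw [← pow_mul, mul_comm]

theorem const_Phi (n : ℕ) : constantCoeff (PhiPS p n) = p := by
  simp [PhiPS]

theorem p_ne : (p : ℤ_[p]) ≠ 0 := PadicInt.prime_p.ne_zero

theorem card_Phi_X (n : ℕ) : Nat.card (PowerSeries ℤ_[p] ⧸ Ideal.span {PhiPS p n, X}) = p := by
  simpa using aux_X (PhiPS p n) 1 1 (by simp [const_Phi])

theorem X_pow_dvd (G : PowerSeries ℤ_[p]) (h : constantCoeff G ≠ 0) (m : ℕ)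
    (x : PowerSeries ℤ_[p]) : X ^ m ∣ x * G → X ^ m ∣ x := by
  intro hx
  exact X_prime.pow_dvd_of_dvd_mul_right m (by rwa [X_dvd_iff]) hx

theorem Phi_const_ne (n : ℕ) : constantCoeff (PhiPS p n) ≠ 0 := by
  rw [const_Phi]; exact p_ne

theorem Phi_ne (n : ℕ) : PhiPS p n ≠ 0 := fun h => Phi_const_ne (p := p) n (by simp [h])

theorem card_Phi_X_pow (n m : ℕ) :
    Nat.card (PowerSeries ℤ_[p] ⧸ Ideal.span {PhiPS p n, X ^ m}) = p ^ m := by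
  induction m with
  | zero =>
    have : Ideal.span {PhiPS p n, (X : PowerSeries ℤ_[p]) ^ 0} = ⊤ := by
      rw [Ideal.eq_top_iff_one]; exact Ideal.subset_span (by simp)
    rw [this]; simp
  | succ m ih =>
    rw [pow_succ, aux_card _ _ _ (pow_ne_zero _ X_ne_zero)
      (X_pow_dvd _ (Phi_const_ne n) m), ih, card_Phi_X, pow_succ]

theorem Phi_not_unit (n : ℕ) : ¬ IsUnit (PhiPS p n) := by
  rw [isUnit_iff_constantCoeff, const_Phi]
  exact PadicInt.prime_p.not_isUnit

theorem Phi_not_dvd_X_pow (n m : ℕ) : ¬ PhiPS p n ∣ X ^ m := by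
  rintro ⟨c, hc⟩
  obtain ⟨d, rfl⟩ := X_pow_dvd (PhiPS p n) (Phi_const_ne n) m c ⟨1, by rw [hc]; ring⟩
  apply Phi_not_unit (p := p) n
  refine IsUnit.of_mul_eq_one d ?_
  have h0 : (X : PowerSeries ℤ_[p]) ^ m ≠ 0 := pow_ne_zero _ X_ne_zero
  apply mul_left_cancel₀ h0
  linear_combination -hc

/-- An element not in `(X, Φ)` is a unit. -/
theorem isUnit_of_not_mem (n : ℕ) (u : PowerSeries ℤ_[p])
    (h : u ∉ Ideal.span {PhiPS p n, X}) : IsUnit u := by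
  rw [isUnit_iff_constantCoeff]
  by_contra hu
  apply h
  have hm : constantCoeff u ∈ IsLocalRing.maximalIdeal ℤ_[p] := hu
  rw [PadicInt.maximalIdeal_eq_span_p, Ideal.mem_span_singleton] at hm
  obtain ⟨c, hc⟩ := hm
  have : X ∣ u - C c * PhiPS p n := by
    rw [X_dvd_iff]; simp [const_Phi, hc, mul_comm]
  obtain ⟨d, hd⟩ := this
  rw [Ideal.mem_span_pair]
  exact ⟨C c, d, by linear_combination -hd⟩

theorem exists_val (n : ℕ) (f : PowerSeries ℤ_[p]) (hf : ¬ PhiPS p n ∣ f) :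
    ∃ (v : ℕ) (u b : PowerSeries ℤ_[p]), IsUnit u ∧ f = X ^ v * u + PhiPS p n * b := by
  classical
  let I : Ideal (PowerSeries ℤ_[p]) := Ideal.span {PhiPS p n}
  have hI : I ≠ ⊤ := by
    intro h
    rw [Ideal.span_singleton_eq_top] at h
    exact Phi_not_unit n h
  have : Nontrivial (PowerSeries ℤ_[p] ⧸ I) := Ideal.Quotient.nontrivial_iff.2 hI
  have : IsLocalRing (PowerSeries ℤ_[p] ⧸ I) :=
    IsLocalRing.of_surjective' (Ideal.Quotient.mk I) Ideal.Quotient.mk_surjective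
  let J : Ideal (PowerSeries ℤ_[p] ⧸ I) := Ideal.span {Ideal.Quotient.mk I X}
  have hmem : ∀ m (g : PowerSeries ℤ_[p]), Ideal.Quotient.mk I g ∈ J ^ m ↔
      ∃ u b, g = X ^ m * u + PhiPS p n * b := by
    intro m g
    rw [Ideal.span_singleton_pow, Ideal.mem_span_singleton]
    constructor
    · rintro ⟨c, hc⟩
      obtain ⟨c, rfl⟩ := Ideal.Quotient.mk_surjective c
      rw [← map_pow, ← map_mul, Ideal.Quotient.mk_eq_mk_iff_sub_mem,
        Ideal.mem_span_singleton] at hc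
      obtain ⟨d, hd⟩ := hc
      exact ⟨c, d, by linear_combination hd⟩
    · rintro ⟨u, b, rfl⟩
      refine ⟨Ideal.Quotient.mk I u, ?_⟩
      rw [← map_pow, ← map_mul, Ideal.Quotient.mk_eq_mk_iff_sub_mem, Ideal.mem_span_singleton]
      exact ⟨b, by ring⟩
  have hJ : J ≠ ⊤ := by
    intro h
    have h1 : Ideal.Quotient.mk I 1 ∈ J ^ 1 := by rw [h]; simp
    obtain ⟨u, b, h2⟩ := (hmem 1 1).1 h1
    have h3 := congrArg constantCoeff h2
    simp [const_Phi] at h3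
    exact PadicInt.prime_p.not_isUnit (IsUnit.of_mul_eq_one _ h3.symm)
  have hbot := Ideal.iInf_pow_eq_bot_of_isLocalRing J hJ
  have hex : ∃ m, ¬ Ideal.Quotient.mk I f ∈ J ^ m := by
    by_contra! h
    apply hf
    have : Ideal.Quotient.mk I f ∈ (⨅ i, J ^ i : Ideal _) := (Submodule.mem_iInf _).2 h
    rw [hbot] at this
    exact Ideal.mem_span_singleton.1 (Ideal.Quotient.eq_zero_iff_mem.1 this)
  have hpos : Nat.find hex ≠ 0 := by
    intro h
    have := Nat.find_spec hex
    rw [h] at this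
    simp at this
  obtain ⟨v, hv⟩ := Nat.exists_eq_succ_of_ne_zero hpos
  have h1 := Nat.find_spec hex
  rw [hv] at h1
  have h2 := Nat.find_min hex (m := v) (by omega)
  rw [not_not, hmem] at h2
  obtain ⟨u, b, rfl⟩ := h2
  refine ⟨v, u, b, isUnit_of_not_mem n u ?_, rfl⟩
  intro hu
  rw [Ideal.mem_span_pair] at hu
  obtain ⟨c, d, rfl⟩ := hu
  apply h1
  rw [hmem]
  exact ⟨d, b + X ^ v * c, by rw [Nat.succ_eq_add_one]; ring⟩

theorem Phi_dvd_unit (n m : ℕ) (u : PowerSeries ℤ_[p]) (hu : IsUnit u) :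
    ¬ PhiPS p n ∣ X ^ m * u := by
  rw [hu.dvd_mul_right]
  exact Phi_not_dvd_X_pow n m

theorem Phi_prime (n : ℕ) : Prime (PhiPS p n) := by
  refine ⟨Phi_ne n, Phi_not_unit n, fun f g h => ?_⟩
  by_contra! hc
  obtain ⟨v, u, b, hu, rfl⟩ := exists_val n f hc.1
  obtain ⟨w, t, c, ht, rfl⟩ := exists_val n g hc.2
  apply Phi_dvd_unit (p := p) n (v + w) (u * t) (hu.mul ht)
  obtain ⟨d, hd⟩ := h
  refine ⟨d - (b * (X ^ w * t + PhiPS p n * c) + X ^ v * u * c), ?_⟩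
  rw [pow_add]
  linear_combination hd

theorem omega_ne (n : ℕ) : omegaPS p n ≠ 0 := by
  induction n with
  | zero => rw [omega_zero]; exact X_ne_zero
  | succ n ih => rw [omega_succ]; exact mul_ne_zero ih (Phi_ne _)

theorem card_F_Phi (n : ℕ) (v : ℕ) (u b : PowerSeries ℤ_[p]) (hu : IsUnit u) :
    Nat.card (PowerSeries ℤ_[p] ⧸ Ideal.span {X ^ v * u + PhiPS p n * b, PhiPS p n}) = p ^ v := by
  rw [← card_Phi_X_pow n v]
  congr 2
  obtain ⟨u, rfl⟩ := hu
  ext f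
  rw [Ideal.mem_span_pair, Ideal.mem_span_pair]
  constructor
  · rintro ⟨c, d, rfl⟩
    exact ⟨c * b + d, c * u, by ring⟩
  · rintro ⟨c, d, rfl⟩
    refine ⟨d * (u⁻¹ : (PowerSeries ℤ_[p])ˣ), c - d * (u⁻¹ : (PowerSeries ℤ_[p])ˣ) * b, ?_⟩
    linear_combination (d * X ^ v) * u.inv_mul

theorem main_ind (F : PowerSeries ℤ_[p]) (n : ℕ)
    (hcop : ∀ q : PowerSeries ℤ_[p], Irreducible q → q ∣ F → ¬ q ∣ omegaPS p n) :
    Finite ((PowerSeries ℤ_[p]) ⧸ (Ideal.span {F, omegaPS p n})) ∧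
      ∀ x, omegaPS p n ∣ x * F → omegaPS p n ∣ x := by
  have key : Nat.card ((PowerSeries ℤ_[p]) ⧸ (Ideal.span {F, omegaPS p n})) ≠ 0 ∧
      ∀ x, omegaPS p n ∣ x * F → omegaPS p n ∣ x := by
    induction n with
    | zero =>
      rw [omega_zero] at *
      have hX : ¬ X ∣ F := fun h => hcop X X_prime.irreducible h dvd_rfl
      rw [X_dvd_iff] at hX
      constructor
      · rw [aux_X F _ _ (PadicInt.unitCoeff_spec hX)]
        exact pow_ne_zero _ (Fact.out : p.Prime).ne_zero
      · intro x hx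
        simpa using X_pow_dvd F hX 1 x (by simpa using hx)
    | succ n ih =>
      obtain ⟨h1, h2⟩ := ih fun q hq hqF h => hcop q hq hqF
        (by rw [omega_succ]; exact h.mul_right _)
      have hP : ¬ PhiPS p (n + 1) ∣ F := fun h => hcop _ (Phi_prime _).irreducible h
        (by rw [omega_succ]; exact dvd_mul_left _ _)
      rw [omega_succ]
      constructor
      · rw [aux_card _ _ _ (omega_ne n) h2]
        refine mul_ne_zero h1 ?_
        obtain ⟨v, u, b, hu, rfl⟩ := exists_val (n + 1) F hP
        rw [card_F_Phi _ _ _ _ hu]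
        exact pow_ne_zero _ (Fact.out : p.Prime).ne_zero
      · intro x hx
        obtain ⟨y, rfl⟩ := h2 x ((dvd_mul_right _ _).trans hx)
        rw [mul_assoc, mul_dvd_mul_iff_left (omega_ne n)] at hx
        exact mul_dvd_mul_left _ (((Phi_prime _).dvd_or_dvd hx).resolve_right hP)
  exact ⟨Nat.finite_of_card_ne_zero key.1, key.2⟩

end

/-- If `F ∈ Λ = Zp[[X]]` is coprime to `ω_n` (no common irreducible factor),
then `Λ/(F, ω_n)` and `Λ/(F, ω_{n-1})` are finite, and the kernel of the natural
projection `π_n : Λ/(F, ω_n) → Λ/(F, ω_{n-1})` is finite of order `p^v`, where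
`v = ord_{ε_n} F(ε_n)`, expressed via the valuation of the image of `F` in the discrete
valuation ring `Λ/(Φ_n) ≅ Zp[ζ_{p^n}]` (in which the image of `X` is `ε_n = ζ_{p^n}-1`,
a uniformizer, normalizing `ord_{ε_n}(ε_n) = 1`). -/
theorem stmt4 (p : ℕ) [hp : Fact p.Prime] (n : ℕ) (hn : 1 ≤ n)
    (F : PowerSeries ℤ_[p])
    (hcop : ∀ q : PowerSeries ℤ_[p], Irreducible q → q ∣ F → ¬ q ∣ omegaPS p n) :
    Finite ((PowerSeries ℤ_[p]) ⧸ (Ideal.span {F, omegaPS p n})) ∧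
    Finite ((PowerSeries ℤ_[p]) ⧸ (Ideal.span {F, omegaPS p (n - 1)})) ∧
    ∃ π : ((PowerSeries ℤ_[p]) ⧸ (Ideal.span {F, omegaPS p n})) →+*
          ((PowerSeries ℤ_[p]) ⧸ (Ideal.span {F, omegaPS p (n - 1)})),
      (∀ f : PowerSeries ℤ_[p],
          π (Ideal.Quotient.mk (Ideal.span {F, omegaPS p n}) f) =
            Ideal.Quotient.mk (Ideal.span {F, omegaPS p (n - 1)}) f) ∧
      ∃ v : ℕ,
        (Ideal.Quotient.mk (Ideal.span {PhiPS p n}) F ∈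
            (Ideal.span {Ideal.Quotient.mk (Ideal.span {PhiPS p n}) PowerSeries.X}) ^ v) ∧
        (Ideal.Quotient.mk (Ideal.span {PhiPS p n}) F ∉
            (Ideal.span {Ideal.Quotient.mk (Ideal.span {PhiPS p n}) PowerSeries.X}) ^ (v + 1)) ∧
        Nat.card (RingHom.ker π) = p ^ v := by
  obtain ⟨n, rfl⟩ : ∃ k, n = k + 1 := ⟨n - 1, by omega⟩
  simp only [Nat.add_sub_cancel]
  have hcop' : ∀ q : PowerSeries ℤ_[p], Irreducible q → q ∣ F → ¬ q ∣ omegaPS p n :=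
    fun q hq hqF h => hcop q hq hqF (by rw [omega_succ]; exact h.mul_right _)
  have hP : ¬ PhiPS p (n + 1) ∣ F := fun h => hcop _ (Phi_prime _).irreducible h
    (by rw [omega_succ]; exact dvd_mul_left _ _)
  have hind := main_ind F n hcop'
  refine ⟨(main_ind F _ hcop).1, hind.1, ?_⟩
  rw [omega_succ]
  refine ⟨Ideal.Quotient.factor (aux_le F _ _), fun f => Ideal.Quotient.factor_mk _ _, ?_⟩
  rw [aux_ker F _ _ (omega_ne n) hind.2 _ (fun f => Ideal.Quotient.factor_mk _ _)]
  obtain ⟨v, u, b, hu, rfl⟩ := exists_val (n + 1) F hP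
  refine ⟨v, ?_, ?_, card_F_Phi _ _ _ _ hu⟩
  · rw [Ideal.span_singleton_pow, Ideal.mem_span_singleton]
    refine ⟨Ideal.Quotient.mk _ u, ?_⟩
    rw [← map_pow, ← map_mul, Ideal.Quotient.mk_eq_mk_iff_sub_mem, Ideal.mem_span_singleton]
    exact ⟨b, by ring⟩
  · rw [Ideal.span_singleton_pow, Ideal.mem_span_singleton]
    rintro ⟨c, hc⟩
    obtain ⟨c, rfl⟩ := Ideal.Quotient.mk_surjective c
    rw [← map_pow, ← map_mul, Ideal.Quotient.mk_eq_mk_iff_sub_mem,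
      Ideal.mem_span_singleton] at hc
    have h1 : PhiPS p (n + 1) ∣ X ^ v * (u - X * c) := by
      obtain ⟨d, hd⟩ := hc
      exact ⟨d - b, by linear_combination hd⟩
    refine Phi_dvd_unit (n + 1) v (u - X * c) ?_ h1
    rw [isUnit_iff_constantCoeff] at hu ⊢
    simpa using hu
end

section
/- Let Λ = Zp[[X]], M a finitely generated torsion Λ-module with maximal finite submodule M′, and suppose there is an injective Λ-homomorphism φ : M/M′ → Λ/(F) with finite cokernel, where F ∈ Λ is coprime to ω_n = (1+X)^{p^n} − 1 for all n ≥ 1. Then for every n ≥ 1 the coinvariant module M_{Γ_n} := M/ω_n M is finite, and e(M/ω_n M) = e(Λ/(F, ω_n)) + e(M′/ω_n M′), where e denotes the p-exponent of the order. -/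
open PowerSeries

/-- `ω_n = (1+X)^{p^n} - 1` in `Λ = Zp[[X]]`. -/
noncomputable def omegaPS8 (p : ℕ) [Fact p.Prime] (n : ℕ) : PowerSeries ℤ_[p] :=
  (1 + PowerSeries.X) ^ p ^ n - 1

theorem aux8_idx {R : Type*} [CommRing R] {M : Type*} [AddCommGroup M] [Module R M]
    (M' : Submodule R M) (w : R)
    (hw : ∀ x : M, w • x ∈ M' → x ∈ M') :
    Nat.card (M ⧸ (Ideal.span {w} • ⊤ : Submodule R M)) =
      Nat.card ((M ⧸ M') ⧸ (Ideal.span {w} • ⊤ : Submodule R (M ⧸ M'))) *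
      Nat.card (M' ⧸ (Ideal.span {w} • ⊤ : Submodule R M')) := by
  set A : Submodule R M := Ideal.span {w} • ⊤ with hA
  have h1 : (Ideal.span {w} • ⊤ : Submodule R (M ⧸ M')) = A.map M'.mkQ := by
    rw [hA, Submodule.map_smul'', Submodule.map_top, Submodule.range_mkQ]
  have h2 : (Ideal.span {w} • ⊤ : Submodule R M') = A.comap M'.subtype := by
    ext x
    simp only [hA, Submodule.mem_comap, Submodule.ideal_span_singleton_smul,
      Submodule.mem_smul_pointwise_iff_exists]
    constructor
    · rintro ⟨y, -, rfl⟩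
      exact ⟨y, trivial, rfl⟩
    · rintro ⟨y, -, hy⟩
      refine ⟨⟨y, hw y (by rw [hy]; exact x.2)⟩, trivial, Subtype.ext hy⟩
  rw [h1, h2]
  change A.toAddSubgroup.index = (A.map M'.mkQ).toAddSubgroup.index *
    (A.comap M'.subtype).toAddSubgroup.index
  have e1 : (A.map M'.mkQ).toAddSubgroup = A.toAddSubgroup.map M'.mkQ.toAddMonoidHom := rfl
  have e2 : (A.comap M'.subtype).toAddSubgroup =
    A.toAddSubgroup.comap M'.subtype.toAddMonoidHom := rfl
  have r1 : M'.mkQ.toAddMonoidHom.range = ⊤ :=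
    AddMonoidHom.range_eq_top.2 M'.mkQ_surjective
  have k1 : M'.mkQ.toAddMonoidHom.ker = M'.toAddSubgroup := by
    ext x; simp [AddMonoidHom.mem_ker]
  have r2 : M'.subtype.toAddMonoidHom.range = M'.toAddSubgroup := by
    ext x; simp
  rw [e1, e2, AddSubgroup.index_map, AddSubgroup.index_comap, r1, k1, r2, AddSubgroup.index_top,
    mul_one, mul_comm, ← AddSubgroup.relIndex_sup_left, AddSubgroup.relIndex_mul_index le_sup_left]

theorem aux8_sub {R : Type*} [CommRing R] {N L : Type*} [AddCommGroup N] [Module R N]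
    [AddCommGroup L] [Module R L] (φ : N →ₗ[R] L) (hφ : Function.Injective φ)
    (hfin : Finite (L ⧸ LinearMap.range φ)) (w : R)
    (hw : ∀ x : L, w • x = 0 → x = 0) :
    Nat.card (N ⧸ (Ideal.span {w} • ⊤ : Submodule R N)) =
      Nat.card (L ⧸ (Ideal.span {w} • ⊤ : Submodule R L)) := by
  set A : Submodule R N := Ideal.span {w} • ⊤ with hA
  set B : Submodule R L := Ideal.span {w} • ⊤ with hB
  have hwinj : Function.Injective (LinearMap.lsmul R L w) := by
    rw [← LinearMap.ker_eq_bot, LinearMap.ker_eq_bot']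
    exact hw
  have h1 : A.map φ = (LinearMap.range φ).map (LinearMap.lsmul R L w) := by
    rw [hA, Submodule.map_smul'', Submodule.map_top, Submodule.ideal_span_singleton_smul]
    rfl
  have h2 : B = LinearMap.range (LinearMap.lsmul R L w) := by
    rw [hB, Submodule.ideal_span_singleton_smul, LinearMap.range_eq_map]
    rfl
  change A.toAddSubgroup.index = B.toAddSubgroup.index
  have h1' : A.toAddSubgroup.map φ.toAddMonoidHom =
      (LinearMap.range φ).toAddSubgroup.map (LinearMap.lsmul R L w).toAddMonoidHom :=
    congrArg Submodule.toAddSubgroup h1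
  have h2' : B.toAddSubgroup = (LinearMap.lsmul R L w).toAddMonoidHom.range := by
    rw [h2]; rfl
  have i1 := AddSubgroup.index_map_of_injective A.toAddSubgroup (f := φ.toAddMonoidHom) hφ
  have i2 := AddSubgroup.index_map_of_injective (LinearMap.range φ).toAddSubgroup
    (f := (LinearMap.lsmul R L w).toAddMonoidHom) hwinj
  have r : φ.toAddMonoidHom.range = (LinearMap.range φ).toAddSubgroup := rfl
  rw [h1', i2, r, mul_comm, ← h2'] at i1
  have hne : (LinearMap.range φ).toAddSubgroup.index ≠ 0 := by
    change Nat.card (L ⧸ LinearMap.range φ) ≠ 0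
    exact Nat.card_pos.ne'
  exact (Nat.eq_of_mul_eq_mul_right (Nat.pos_of_ne_zero hne) i1).symm

theorem aux8_omega (p : ℕ) [Fact p.Prime] (n : ℕ) :
    (omegaPS8 p n).map (IsLocalRing.residue ℤ_[p]) ≠ 0 := by
  intro h
  have h1 := congrArg (PowerSeries.coeff (p ^ n)) h
  have hp : p ^ n ≠ 0 := pow_ne_zero _ (Fact.out : p.Prime).ne_zero
  have key : omegaPS8 p n = (((1 + Polynomial.X) ^ p ^ n - 1 : Polynomial ℤ_[p]) : PowerSeries ℤ_[p]) := by
    simp [omegaPS8]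
  rw [key, PowerSeries.coeff_map, Polynomial.coeff_coe, Polynomial.coeff_sub,
    Polynomial.coeff_one_add_X_pow, Polynomial.coeff_one] at h1
  rw [if_neg hp] at h1
  simp at h1

theorem aux8_modfin (p : ℕ) [Fact p.Prime] (n : ℕ) :
    Module.Finite ℤ_[p] (PowerSeries ℤ_[p] ⧸ Ideal.span {omegaPS8 p n}) := by
  obtain ⟨f, h, H⟩ := PowerSeries.exists_isWeierstrassFactorization (aux8_omega p n)
  have := H.isDistinguishedAt.monic.finite_quotient
  exact Module.Finite.equiv H.algEquivQuotient.toLinearEquiv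

theorem aux8_Zp (p : ℕ) [Fact p.Prime] (c : ℤ_[p]) (hc : c ≠ 0) :
    Finite (ℤ_[p] ⧸ Ideal.span {c}) := by
  obtain ⟨k, hk⟩ := PadicInt.ideal_eq_span_pow_p (s := Ideal.span {c}) (by simpa using hc)
  rw [hk, ← PadicInt.ker_toZModPow]
  haveI : NeZero (p ^ k) := ⟨pow_ne_zero _ (Fact.out : p.Prime).ne_zero⟩
  exact Finite.of_injective _ (RingHom.kerLift_injective (PadicInt.toZModPow (p := p) k))

theorem aux8_ann {R A : Type*} [CommRing R] [IsDomain R] [CommRing A] [Algebra R A]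
    [Module.Finite R A] (f : A) (hf : ∀ x, f * x = 0 → x = 0) :
    ∃ c : R, c ≠ 0 ∧ algebraMap R A c ∈ Ideal.span {f} := by
  obtain ⟨P, hP, hev⟩ := Algebra.IsIntegral.isIntegral (R := R) f
  have hP0 : P ≠ 0 := hP.ne_zero
  obtain ⟨Q, hQ, hnd⟩ := Polynomial.exists_eq_pow_rootMultiplicity_mul_and_not_dvd P hP0 0
  have hQ0 : Q.coeff 0 ≠ 0 := by
    simpa [Polynomial.X_dvd_iff] using hnd
  refine ⟨Q.coeff 0, hQ0, ?_⟩
  have hpow : ∀ (k : ℕ) (x : A), f ^ k * x = 0 → x = 0 := by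
    intro k
    induction k with
    | zero => intro x hx; simpa using hx
    | succ k ih => intro x hx; exact ih x (hf _ (by rw [← hx]; ring))
  have hQf : Polynomial.aeval f Q = 0 := by
    apply hpow (P.rootMultiplicity 0)
    have : Polynomial.aeval f P = 0 := hev
    rw [hQ] at this
    simpa using this
  have := Polynomial.divX_mul_X_add Q
  rw [← this] at hQf
  simp only [map_add, map_mul, Polynomial.aeval_X, Polynomial.aeval_C] at hQf
  rw [Ideal.mem_span_singleton]
  exact ⟨-Polynomial.aeval f Q.divX, by linear_combination hQf⟩

theorem aux8_gen {R B : Type*} [CommRing R] [CommRing B] [Algebra R B] [Module.Finite R B]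
    (c : R) [Finite (R ⧸ Ideal.span {c})] (hc0 : algebraMap R B c = 0) : Finite B := by
  have htor : Module.IsTorsionBySet R B (Ideal.span {c} : Ideal R) := by
    rintro x ⟨a, ha⟩
    obtain ⟨b, rfl⟩ := Ideal.mem_span_singleton.1 ha
    change (c * b) • x = 0
    rw [Algebra.smul_def, map_mul, hc0, zero_mul, zero_mul]
  letI := htor.module
  haveI : Module.Finite (R ⧸ Ideal.span {c}) B :=
    Module.Finite.of_restrictScalars_finite R _ _
  exact Module.finite_of_finite (R ⧸ Ideal.span {c})

theorem aux8_fin (p : ℕ) [Fact p.Prime] (n : ℕ) (F : PowerSeries ℤ_[p])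
    (hF : IsRelPrime F (omegaPS8 p n)) :
    Finite (PowerSeries ℤ_[p] ⧸ (Ideal.span {F, omegaPS8 p n})) := by
  haveI := aux8_modfin p n
  obtain ⟨c, hc, hmem⟩ := aux8_ann (R := ℤ_[p])
    (Ideal.Quotient.mk (Ideal.span {omegaPS8 p n}) F) (by
      intro x hx
      obtain ⟨x, rfl⟩ := Ideal.Quotient.mk_surjective x
      rw [← map_mul, Ideal.Quotient.eq_zero_iff_mem, Ideal.mem_span_singleton] at hx
      rw [Ideal.Quotient.eq_zero_iff_mem, Ideal.mem_span_singleton]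
      exact hF.symm.dvd_of_dvd_mul_left hx)
  have hle : Ideal.span {omegaPS8 p n} ≤ Ideal.span {F, omegaPS8 p n} :=
    Ideal.span_mono (by simp)
  let π := Ideal.Quotient.factorₐ ℤ_[p] hle
  have hπ : Function.Surjective π := Ideal.Quotient.factor_surjective hle
  haveI : Module.Finite ℤ_[p] (PowerSeries ℤ_[p] ⧸ (Ideal.span {F, omegaPS8 p n})) :=
    Module.Finite.of_surjective π.toLinearMap hπ
  have hc0 : algebraMap ℤ_[p] (PowerSeries ℤ_[p] ⧸ (Ideal.span {F, omegaPS8 p n})) c = 0 := by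
    rw [Ideal.mem_span_singleton] at hmem
    obtain ⟨y, hy⟩ := hmem
    have h3 := congrArg π hy
    rw [AlgHom.commutes, map_mul] at h3
    have : π (Ideal.Quotient.mk (Ideal.span {omegaPS8 p n}) F) = 0 := by
      change Ideal.Quotient.mk (Ideal.span {F, omegaPS8 p n}) F = 0
      rw [Ideal.Quotient.eq_zero_iff_mem]
      exact Ideal.subset_span (by simp)
    rw [h3, this, zero_mul]
  haveI := aux8_Zp p c hc
  exact aux8_gen c hc0

/-- Let `M` be a finitely generated torsion `Λ = Zp[[X]]`-module with
maximal finite submodule `M′`, and `φ : M/M′ → Λ/(F)` an injective `Λ`-map with finite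
cokernel, where `F` is coprime to `ω_n` for all `n ≥ 1`.  Then for every `n ≥ 1` the
coinvariants `M/ω_n M` are finite and
`e(M/ω_n M) = e(Λ/(F, ω_n)) + e(M′/ω_n M′)`. -/
theorem stmt8 (p : ℕ) [hp : Fact p.Prime]
    (M : Type*) [AddCommGroup M] [Module (PowerSeries ℤ_[p]) M]
    [Module.Finite (PowerSeries ℤ_[p]) M]
    (htors : Module.IsTorsion (PowerSeries ℤ_[p]) M)
    (M' : Submodule (PowerSeries ℤ_[p]) M) (hM'fin : Finite M')
    (hM'max : ∀ N : Submodule (PowerSeries ℤ_[p]) M, Finite N → N ≤ M')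
    (F : PowerSeries ℤ_[p])
    (hcop : ∀ n : ℕ, 1 ≤ n →
      ∀ q : PowerSeries ℤ_[p], Irreducible q → q ∣ F → ¬ q ∣ omegaPS8 p n)
    (φ : (M ⧸ M') →ₗ[PowerSeries ℤ_[p]] (PowerSeries ℤ_[p] ⧸ Ideal.span {F}))
    (hinj : Function.Injective φ)
    (hcoker : Finite ((PowerSeries ℤ_[p] ⧸ Ideal.span {F}) ⧸ LinearMap.range φ)) :
    ∀ n : ℕ, 1 ≤ n →
      Finite (M ⧸ (Ideal.span {omegaPS8 p n} • ⊤ : Submodule (PowerSeries ℤ_[p]) M)) ∧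
      Finite ((PowerSeries ℤ_[p]) ⧸ (Ideal.span {F, omegaPS8 p n})) ∧
      Finite (M' ⧸ (Ideal.span {omegaPS8 p n} • ⊤ : Submodule (PowerSeries ℤ_[p]) M')) ∧
      (Nat.card
          (M ⧸ (Ideal.span {omegaPS8 p n} • ⊤ : Submodule (PowerSeries ℤ_[p]) M))).factorization p =
        (Nat.card ((PowerSeries ℤ_[p]) ⧸ (Ideal.span {F, omegaPS8 p n}))).factorization p +
        (Nat.card
          (M' ⧸ (Ideal.span {omegaPS8 p n} • ⊤ : Submodule (PowerSeries ℤ_[p]) M'))).factorization p := by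
  intro n hn
  set w := omegaPS8 p n with hwdef
  have hF : F ≠ 0 := by
    rintro rfl
    refine hcop 1 le_rfl PowerSeries.X PowerSeries.X_prime.irreducible (dvd_zero _) ?_
    rw [PowerSeries.X_dvd_iff]
    simp [omegaPS8]
  have hrel : IsRelPrime F w :=
    WfDvdMonoid.isRelPrime_of_no_irreducible_factors (fun h => hF h.1)
      (fun q hq h1 h2 => hcop n hn q hq h1 h2)
  have hfinL : Finite ((PowerSeries ℤ_[p]) ⧸ (Ideal.span {F, w})) := aux8_fin p n F hrel
  have hwL : ∀ x : PowerSeries ℤ_[p] ⧸ Ideal.span {F}, w • x = 0 → x = 0 := by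
    intro x hx
    obtain ⟨x, rfl⟩ := Ideal.Quotient.mk_surjective x
    change Ideal.Quotient.mk (Ideal.span {F}) (w * x) = 0 at hx
    rw [Ideal.Quotient.eq_zero_iff_mem, Ideal.mem_span_singleton] at hx ⊢
    exact hrel.dvd_of_dvd_mul_left hx
  have hwM : ∀ x : M, w • x ∈ M' → x ∈ M' := by
    intro x hx
    rw [← Submodule.Quotient.mk_eq_zero] at hx ⊢
    apply hinj
    rw [map_zero]
    apply hwL
    rw [← map_smul, ← Submodule.Quotient.mk_smul, hx, map_zero]
  have c1 := aux8_idx M' w hwM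
  have c2 := aux8_sub φ hinj hcoker w hwL
  have c3 : Nat.card ((PowerSeries ℤ_[p] ⧸ Ideal.span {F}) ⧸
      (Ideal.span {w} • ⊤ : Submodule (PowerSeries ℤ_[p]) (PowerSeries ℤ_[p] ⧸ Ideal.span {F}))) =
      Nat.card ((PowerSeries ℤ_[p]) ⧸ (Ideal.span {F, w})) := by
    have hm : (Ideal.span {w} • ⊤ : Submodule (PowerSeries ℤ_[p])
        (PowerSeries ℤ_[p] ⧸ Ideal.span {F})) =
        Submodule.map (Submodule.mkQ (Ideal.span {F})) (Ideal.span {w}) := by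
      rw [← Submodule.range_mkQ, ← Submodule.map_top, ← Submodule.map_smul'']
      congr 1
      simp
    rw [hm]
    have hs : Ideal.span {F, w} = Ideal.span {F} ⊔ Ideal.span {w} := by
      rw [Ideal.span_insert]
    rw [hs]
    exact Nat.card_congr (Submodule.quotientQuotientEquivQuotientSup _ _).toEquiv
  haveI : Finite (M' ⧸ (Ideal.span {w} • ⊤ : Submodule (PowerSeries ℤ_[p]) M')) :=
    Finite.of_surjective _ (Submodule.mkQ_surjective _)
  rw [c2, c3] at c1
  have n1 : Nat.card ((PowerSeries ℤ_[p]) ⧸ (Ideal.span {F, w})) ≠ 0 := Nat.card_pos.ne'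
  have n2 : Nat.card (M' ⧸ (Ideal.span {w} • ⊤ : Submodule (PowerSeries ℤ_[p]) M')) ≠ 0 :=
    Nat.card_pos.ne'
  refine ⟨Nat.finite_of_card_ne_zero (by rw [c1]; exact mul_ne_zero n1 n2), hfinL, this, ?_⟩
  rw [c1, Nat.factorization_mul n1 n2]
  rfl
end

section
/- Let p be prime, Λ = Zp[[X]], and M a finitely generated torsion Λ-module whose characteristic ideal is coprime to ω_m for all m ≥ 1. Let n₀ be such that every irreducible distinguished polynomial dividing a generator F of the characteristic ideal has degree < p^{n₀−1}(p−1). Then for all n ≥ n₀: e(M/ω_n M) − e(M/ω_{n₀} M) = μ(M)·(p^n − p^{n₀}) + λ(M)·(n − n₀) + e(M′/ω_n M′) − e(M′/ω_{n₀} M′), where M′ is the maximal finite submodule of M, μ(M) and λ(M) are the Iwasawa μ- and λ-invariants, and e denotes the p-exponent of the order of a finite module. -/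
open PowerSeries

/-- `ω_n = (1+X)^{p^n} - 1` in `Λ = Zp[[X]]`. -/
noncomputable def omegaPS10 (p : ℕ) [Fact p.Prime] (n : ℕ) : PowerSeries ℤ_[p] :=
  (1 + PowerSeries.X) ^ p ^ n - 1

namespace Iwa10

section general
variable {R : Type*} [CommRing R]

/-- Multiplication by `a` as an additive endomorphism. -/
def mulHom (a : R) (E : Type*) [AddCommGroup E] [Module R E] : E →+ E :=
  DistribSMul.toAddMonoidHom E a

@[simp] lemma mulHom_apply (a : R) (E : Type*) [AddCommGroup E] [Module R E] (x : E) :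
    mulHom a E x = a • x := rfl

/-- The index of `aE` in `E`. -/
noncomputable def ix (a : R) (E : Type*) [AddCommGroup E] [Module R E] : ℕ :=
  (mulHom a E).range.index

lemma mem_range_mulHom {a : R} {E : Type*} [AddCommGroup E] [Module R E] {x : E} :
    x ∈ (mulHom a E).range ↔ ∃ y, a • y = x := Iff.rfl

lemma toAddSubgroup_smul (a : R) (E : Type*) [AddCommGroup E] [Module R E] :
    (Ideal.span {a} • ⊤ : Submodule R E).toAddSubgroup = (mulHom a E).range := by
  ext x
  rw [Submodule.ideal_span_singleton_smul, Submodule.mem_toAddSubgroup,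
    Submodule.mem_smul_pointwise_iff_exists, mem_range_mulHom]
  simp

lemma card_eq_ix (a : R) (E : Type*) [AddCommGroup E] [Module R E] :
    Nat.card (E ⧸ (Ideal.span {a} • ⊤ : Submodule R E)) = ix a E := by
  rw [ix, ← toAddSubgroup_smul]
  rfl

lemma ix_mul (a b : R) (E : Type*) [AddCommGroup E] [Module R E]
    (ha : Function.Injective (mulHom a E)) : ix (a * b) E = ix a E * ix b E := by
  have h : (mulHom (a * b) E).range = (mulHom b E).range.map (mulHom a E) := by
    ext x
    simp [mul_smul]
  rw [ix, h, AddSubgroup.index_map_of_injective _ ha, mul_comm]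
  rfl

/-- submodule of finite index -/
lemma ix_of_injective (a : R) {N E : Type*} [AddCommGroup E] [Module R E] [AddCommGroup N]
    [Module R N] (φ : N →ₗ[R] E) (hφ : Function.Injective φ)
    (ha : Function.Injective (mulHom a E)) (hfin : φ.range.toAddSubgroup.index ≠ 0) :
    ix a N = ix a E := by
  have h1 : ((mulHom a N).range.map φ.toAddMonoidHom) =
      (φ.toAddMonoidHom.range.map (mulHom a E)) := by
    ext x
    simp
  have h2 := AddSubgroup.index_map_of_injective (f := φ.toAddMonoidHom) (mulHom a N).range hφ
  rw [h1, AddSubgroup.index_map_of_injective _ ha] at h2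
  have h3 : φ.range.toAddSubgroup = φ.toAddMonoidHom.range := by
    ext x; simp
  rw [h3] at hfin
  rw [mul_comm] at h2
  exact (Nat.eq_of_mul_eq_mul_right (Nat.pos_of_ne_zero hfin) h2).symm

lemma ix_ext (a : R) {M : Type*} [AddCommGroup M] [Module R M] (M' : Submodule R M)
    (ha : Function.Injective (mulHom a (M ⧸ M'))) :
    ix a M = ix a M' * ix a (M ⧸ M') := by
  have h1 : (mulHom a (M ⧸ M')).range.comap (M'.mkQ.toAddMonoidHom) =
      (mulHom a M).range ⊔ M'.toAddSubgroup := by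
    ext x
    simp only [AddSubgroup.mem_comap, mem_range_mulHom, AddSubgroup.mem_sup]
    constructor
    · rintro ⟨y, hy⟩
      obtain ⟨y, rfl⟩ := M'.mkQ_surjective y
      refine ⟨a • y, ⟨y, rfl⟩, x - a • y, ?_, by abel⟩
      have : M'.mkQ (x - a • y) = 0 := by
        rw [map_sub, map_smul, hy]; simp
      exact (Submodule.Quotient.mk_eq_zero M').1 this
    · rintro ⟨_, ⟨y, rfl⟩, z, hz, rfl⟩
      refine ⟨M'.mkQ y, ?_⟩
      have : M'.mkQ z = 0 := by simpa using hz
      simp only [LinearMap.toAddMonoidHom_coe, map_add, map_smul, this, add_zero]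
  have h2 : (mulHom a M).range.relIndex M'.toAddSubgroup = ix a M' := by
    rw [AddSubgroup.relIndex, ix]
    congr 1
    ext ⟨x, hx⟩
    rw [AddSubgroup.mem_addSubgroupOf]
    constructor
    · rintro ⟨y, hy⟩
      have hy : a • y = x := hy
      have : M'.mkQ y = 0 := by
        apply ha
        simp only [mulHom_apply, smul_zero, ← map_smul, hy]
        simpa using hx
      exact ⟨⟨y, by simpa using this⟩, Subtype.ext hy⟩
    · rintro ⟨⟨y, hy⟩, h⟩
      exact ⟨y, congrArg Subtype.val h⟩
  rw [ix, ← AddSubgroup.relIndex_mul_index (le_sup_left : _ ≤ (mulHom a M).range ⊔ M'.toAddSubgroup),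
    AddSubgroup.relIndex_sup_left, h2, ← h1, AddSubgroup.index_comap_of_surjective _
      (M'.mkQ_surjective)]
  rfl

lemma ix_pi (a : R) {ι : Type*} [Fintype ι] (E : ι → Type*) [∀ i, AddCommGroup (E i)]
    [∀ i, Module R (E i)] : ix a (∀ i, E i) = ∏ i, ix a (E i) := by
  classical
  have h : (Ideal.span {a} • ⊤ : Submodule R (∀ i, E i)) =
      Submodule.pi Set.univ fun i => (Ideal.span {a} • ⊤ : Submodule R (E i)) := by
    ext x
    simp only [Submodule.ideal_span_singleton_smul, Submodule.mem_pi,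
      Submodule.mem_smul_pointwise_iff_exists, Submodule.mem_top, true_and, Set.mem_univ,
      forall_true_left]
    constructor
    · rintro ⟨y, rfl⟩ i
      exact ⟨y i, rfl⟩
    · intro h
      choose y hy using h
      exact ⟨y, funext hy⟩
  rw [← card_eq_ix, h, Nat.card_congr (Submodule.quotientPi _).toEquiv, Nat.card_pi]
  simp_rw [card_eq_ix]

/-- `#(R/(f,a))`. -/
noncomputable def cc (f a : R) : ℕ := (Ideal.span {f} ⊔ Ideal.span {a}).toAddSubgroup.index

lemma cc_comm (f a : R) : cc f a = cc a f := by rw [cc, cc, sup_comm]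

lemma ix_quot (f a : R) : ix a (R ⧸ Ideal.span {f}) = cc f a := by
  have : (Ideal.span {f} ⊔ Ideal.span {a}).toAddSubgroup =
      (mulHom a (R ⧸ Ideal.span {f})).range.comap
        (Ideal.Quotient.mk (Ideal.span {f})).toAddMonoidHom := by
    ext x
    simp only [AddSubgroup.mem_comap, mem_range_mulHom, Submodule.mem_toAddSubgroup,
      Submodule.mem_sup]
    constructor
    · rintro ⟨y, hy, z, hz, rfl⟩
      obtain ⟨w, rfl⟩ := Ideal.mem_span_singleton'.1 hz
      refine ⟨Ideal.Quotient.mk _ w, ?_⟩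
      have : Ideal.Quotient.mk (Ideal.span {f}) y = 0 := Ideal.Quotient.eq_zero_iff_mem.2 hy
      change Ideal.Quotient.mk (Ideal.span {f}) (a * w) = Ideal.Quotient.mk _ (y + w * a)
      rw [map_add, this, zero_add, mul_comm]
    · rintro ⟨y, hy⟩
      obtain ⟨y, rfl⟩ := Ideal.Quotient.mk_surjective y
      refine ⟨x - a * y, ?_, a * y, Ideal.mem_span_singleton.2 (dvd_mul_right _ _), by ring⟩
      apply Ideal.Quotient.eq_zero_iff_mem.1
      have hy : Ideal.Quotient.mk (Ideal.span {f}) (a * y) = Ideal.Quotient.mk _ x := hy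
      rw [map_sub, hy, sub_self]
  rw [cc, this, AddSubgroup.index_comap_of_surjective _ Ideal.Quotient.mk_surjective]
  rfl

/-- `a` is a nonzerodivisor modulo `f`. -/
def Reg (f a : R) : Prop := ∀ x, f ∣ a * x → f ∣ x

lemma Reg.injective {f a : R} (h : Reg f a) :
    Function.Injective (mulHom a (R ⧸ Ideal.span {f})) := by
  rw [injective_iff_map_eq_zero]
  intro x hx
  obtain ⟨x, rfl⟩ := Ideal.Quotient.mk_surjective x
  rw [Ideal.Quotient.eq_zero_iff_dvd]
  apply h
  rw [← Ideal.Quotient.eq_zero_iff_dvd]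
  exact hx

lemma Reg.cc_mul {f a : R} (h : Reg f a) (b : R) : cc f (a * b) = cc f a * cc f b := by
  simp only [← ix_quot]
  exact ix_mul a b _ h.injective

lemma Reg.of_mul_left {f a b : R} (h : Reg f (a * b)) : Reg f a := fun x hx =>
  h x (by rw [mul_right_comm]; exact hx.mul_right b)

lemma Reg.of_mul_right {f a b : R} (h : Reg f (a * b)) : Reg f b := by
  rw [mul_comm] at h; exact h.of_mul_left

lemma Reg.pow {f a : R} (h : Reg f a) (n : ℕ) : Reg f (a ^ n) := by
  induction n with
  | zero => intro x hx; simpa using hx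
  | succ n ih => intro x hx; rw [pow_succ, mul_assoc] at hx; exact h _ (ih _ hx)

lemma cc_one (f : R) : cc f 1 = 1 := by
  simp [cc]

lemma Reg.cc_pow {f a : R} (h : Reg f a) (n : ℕ) : cc f (a ^ n) = cc f a ^ n := by
  induction n with
  | zero => simp [cc_one]
  | succ n ih => rw [pow_succ, pow_succ, (h.pow n).cc_mul, ih]

lemma cc_unit (f a : R) (u : Rˣ) : cc f (u * a) = cc f a := by
  rw [cc, cc, Ideal.span_singleton_mul_left_unit u.isUnit]

lemma Reg.symm [IsDomain R] {f a : R} (h : Reg f a) (hf : f ≠ 0) : Reg a f := by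
  rintro x ⟨y, hy⟩
  obtain ⟨z, rfl⟩ := h y ⟨x, hy.symm⟩
  refine ⟨z, mul_left_cancel₀ hf ?_⟩
  rw [hy]; ring

lemma Reg.mul [IsDomain R] {f g a : R} (hf : Reg f a) (hg : Reg g a) (hf0 : f ≠ 0) :
    Reg (f * g) a := by
  rintro x ⟨z, hz⟩
  obtain ⟨y, rfl⟩ := hf x ⟨g * z, by rw [hz]; ring⟩
  refine mul_dvd_mul_left f (hg y ⟨z, mul_left_cancel₀ hf0 ?_⟩)
  linear_combination hz

lemma Reg.mul_cc [IsDomain R] {f a : R} (h : Reg f a) (hf : f ≠ 0) (g : R) :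
    cc (f * g) a = cc f a * cc g a := by
  rw [cc_comm, (h.symm hf).cc_mul, cc_comm, cc_comm a g]

lemma Reg.pow_left [IsDomain R] {f a : R} (hf : Reg f a) (hf0 : f ≠ 0) (n : ℕ) :
    Reg (f ^ n) a := by
  induction n with
  | zero => intro x hx; simp
  | succ n ih => rw [pow_succ]; exact ih.mul hf (pow_ne_zero _ hf0)

lemma Reg.pow_cc [IsDomain R] {f a : R} (hf : Reg f a) (hf0 : f ≠ 0) (n : ℕ) :
    cc (f ^ n) a = cc f a ^ n := by
  rw [cc_comm, (hf.symm hf0).cc_pow, cc_comm]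

lemma reg_unit (u : Rˣ) (a : R) : Reg (u : R) a := fun _ _ => u.isUnit.dvd

lemma reg_prime {f a : R} (hf : Prime f) (h : ¬ f ∣ a) : Reg f a := fun _ hx =>
  (hf.dvd_or_dvd hx).resolve_left h

/-- Everything reduces to the product of the `R/(F_i)`. -/
lemma ix_main (a : R) {M : Type*} [AddCommGroup M] [Module R M] (M' : Submodule R M)
    {r : ℕ} (Fs : Fin r → R) (φ : (M ⧸ M') →ₗ[R] (∀ i, R ⧸ Ideal.span {Fs i}))
    (hinj : Function.Injective φ)
    (hcoker : Finite ((∀ i : Fin r, R ⧸ Ideal.span {Fs i}) ⧸ LinearMap.range φ))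
    (hreg : ∀ i, Reg (Fs i) a) :
    ix a M = ix a M' * ∏ i, cc (Fs i) a := by
  have hE : Function.Injective (mulHom a (∀ i, R ⧸ Ideal.span {Fs i})) := by
    intro x y hxy
    funext i
    exact (hreg i).injective (congrFun hxy i)
  have hN : Function.Injective (mulHom a (M ⧸ M')) := by
    intro x y hxy
    apply hinj
    apply hE
    simp only [mulHom_apply, ← map_smul] at hxy ⊢
    rw [hxy]
  have hfin : φ.range.toAddSubgroup.index ≠ 0 := by
    have : Nat.card ((∀ i : Fin r, R ⧸ Ideal.span {Fs i}) ⧸ LinearMap.range φ) ≠ 0 :=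
      Nat.card_pos.ne'
    exact this
  rw [ix_ext a M' hN, ix_of_injective a φ hinj hE hfin, ix_pi]
  simp_rw [ix_quot]

end general

section padic
variable (p : ℕ) [hp : Fact p.Prime]

/-- Reduction modulo `p`. -/
noncomputable def red : PowerSeries ℤ_[p] →+* PowerSeries (ZMod p) :=
  PowerSeries.map (PadicInt.toZMod)

lemma toZMod_eq_zero_iff (x : ℤ_[p]) : PadicInt.toZMod x = 0 ↔ x ∈ Ideal.span {(p : ℤ_[p])} := by
  rw [← RingHom.mem_ker, PadicInt.ker_toZMod, PadicInt.maximalIdeal_eq_span_p]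

lemma red_eq_zero_iff (f : PowerSeries ℤ_[p]) : red p f = 0 ↔ (p : PowerSeries ℤ_[p]) ∣ f := by
  constructor
  · intro h
    have h1 : ∀ n, (p : ℤ_[p]) ∣ PowerSeries.coeff n f := by
      intro n
      rw [← Ideal.mem_span_singleton, ← toZMod_eq_zero_iff]
      have := congrArg (PowerSeries.coeff n) h
      simpa [red] using this
    choose c hc using h1
    refine ⟨PowerSeries.mk c, ?_⟩
    ext n
    have : (p : PowerSeries ℤ_[p]) = PowerSeries.C (p : ℤ_[p]) := by simp
    rw [this, PowerSeries.coeff_C_mul, PowerSeries.coeff_mk, hc]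
  · rintro ⟨g, rfl⟩
    have : (p : PowerSeries (ZMod p)) = PowerSeries.C (p : ZMod p) :=
      (map_natCast PowerSeries.C p).symm
    rw [map_mul, map_natCast, this, CharP.cast_eq_zero, map_zero, zero_mul]

lemma p_ne_zero : (p : PowerSeries ℤ_[p]) ≠ 0 := by
  intro h
  have := congrArg PowerSeries.constantCoeff h
  simp [hp.out.ne_zero] at this

lemma p_prime : Prime (p : PowerSeries ℤ_[p]) := by
  refine ⟨p_ne_zero p, ?_, ?_⟩
  · intro h
    have := h.map (red p)
    rw [(red_eq_zero_iff p _).2 dvd_rfl] at this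
    exact not_isUnit_zero this
  · intro a b h
    rw [← red_eq_zero_iff, map_mul, mul_eq_zero] at h
    simpa [red_eq_zero_iff] using h

lemma red_X : red p PowerSeries.X = PowerSeries.X := by simp [red]

lemma red_eq_X_pow {f : PowerSeries ℤ_[p]} {d : ℕ} (h : red p f = PowerSeries.X ^ d) :
    ∃ s : PowerSeries ℤ_[p], f = PowerSeries.X ^ d + (p : PowerSeries ℤ_[p]) * s := by
  have : red p (f - PowerSeries.X ^ d) = 0 := by
    rw [map_sub, map_pow, h, red_X, sub_self]
  obtain ⟨s, hs⟩ := (red_eq_zero_iff p _).1 this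
  exact ⟨s, by rw [← hs]; ring⟩

lemma not_p_dvd {f : PowerSeries ℤ_[p]} {d : ℕ} (h : red p f = PowerSeries.X ^ d) :
    ¬ (p : PowerSeries ℤ_[p]) ∣ f := by
  rw [← red_eq_zero_iff, h]
  exact pow_ne_zero _ PowerSeries.X_ne_zero

lemma reg_p {f : PowerSeries ℤ_[p]} {d : ℕ} (h : red p f = PowerSeries.X ^ d) :
    Reg (p : PowerSeries ℤ_[p]) f := reg_prime (p_prime p) (not_p_dvd p h)

lemma cc_p_X : cc (p : PowerSeries ℤ_[p]) PowerSeries.X = p := by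
  have h : (Ideal.span {(p : PowerSeries ℤ_[p])} ⊔ Ideal.span {PowerSeries.X}).toAddSubgroup =
      ((PadicInt.toZMod (p := p)).comp (PowerSeries.constantCoeff)).toAddMonoidHom.ker := by
    ext f
    simp only [Submodule.mem_toAddSubgroup, Submodule.mem_sup, AddMonoidHom.mem_ker]
    change _ ↔ PadicInt.toZMod (PowerSeries.constantCoeff f) = 0
    rw [toZMod_eq_zero_iff, Ideal.mem_span_singleton]
    constructor
    · rintro ⟨y, hy, z, hz, rfl⟩
      rw [Ideal.mem_span_singleton] at hy hz
      obtain ⟨y, rfl⟩ := hy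
      obtain ⟨z, rfl⟩ := hz
      simp
    · rintro ⟨c, hc⟩
      refine ⟨p * PowerSeries.C c, Ideal.mem_span_singleton.2 (dvd_mul_right _ _),
        f - p * PowerSeries.C c, Ideal.mem_span_singleton.2 ?_, by ring⟩
      rw [PowerSeries.X_dvd_iff]
      simp [hc]
  have hsurj : Function.Surjective
      ((PadicInt.toZMod (p := p)).comp (PowerSeries.constantCoeff)).toAddMonoidHom := by
    intro y
    obtain ⟨x, rfl⟩ := ZMod.ringHom_surjective (PadicInt.toZMod (p := p)) y
    exact ⟨PowerSeries.C x, by simp⟩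
  rw [cc, h, AddSubgroup.index_ker, AddMonoidHom.range_eq_top.2 hsurj]
  simp

lemma cc_p {f : PowerSeries ℤ_[p]} {d : ℕ} (h : red p f = PowerSeries.X ^ d) :
    cc (p : PowerSeries ℤ_[p]) f = p ^ d := by
  obtain ⟨s, rfl⟩ := red_eq_X_pow p h
  have hX : Reg (p : PowerSeries ℤ_[p]) PowerSeries.X :=
    reg_p p (d := 1) (by rw [red_X, pow_one])
  calc cc (p : PowerSeries ℤ_[p]) (PowerSeries.X ^ d + (p : PowerSeries ℤ_[p]) * s)
      = cc (p : PowerSeries ℤ_[p]) (PowerSeries.X ^ d) := by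
        rw [cc, cc, ← Ideal.span_union, ← Ideal.span_union]
        simp only [Set.singleton_union]
        rw [mul_comm, Ideal.span_pair_add_mul_left]
    _ = p ^ d := by rw [hX.cc_pow, cc_p_X]

/-- `ν_n = ω_{n+1}/ω_n`. -/
noncomputable def nu (n : ℕ) : PowerSeries ℤ_[p] :=
  ∑ i ∈ Finset.range p, ((1 + PowerSeries.X) ^ p ^ n) ^ i

lemma omega_succ (n : ℕ) : omegaPS10 p (n + 1) = omegaPS10 p n * nu p n := by
  rw [omegaPS10, omegaPS10, nu, mul_geom_sum, ← pow_mul, ← pow_succ]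

lemma red_omega (n : ℕ) : red p (omegaPS10 p n) = PowerSeries.X ^ p ^ n := by
  have : CharP (PowerSeries (ZMod p)) p :=
    charP_of_injective_algebraMap (R := ZMod p) (PowerSeries.C_injective) p
  rw [omegaPS10, map_sub, map_pow, map_add, map_one, red_X, add_pow_char_pow]
  simp

lemma red_nu (n : ℕ) : red p (nu p n) = PowerSeries.X ^ (p ^ (n + 1) - p ^ n) := by
  have h := congrArg (red p) (omega_succ p n)
  rw [map_mul, red_omega, red_omega] at h
  refine mul_left_cancel₀ (pow_ne_zero (p ^ n) PowerSeries.X_ne_zero) ?_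
  rw [← h, ← pow_add, Nat.add_sub_cancel' (Nat.pow_le_pow_right hp.out.pos (Nat.le_succ n))]

lemma constantCoeff_nu (n : ℕ) : PowerSeries.constantCoeff (nu p n) = p := by
  simp [nu]

lemma omega_ne_zero (n : ℕ) : omegaPS10 p n ≠ 0 := by
  intro h
  exact not_p_dvd p (red_omega p n) (h ▸ dvd_zero _)

/-- Distinguished polynomials. -/
def Dist (g : Polynomial ℤ_[p]) : Prop :=
  g.Monic ∧ g.map PadicInt.toZMod = Polynomial.X ^ g.natDegree

lemma dist_iff {g : Polynomial ℤ_[p]} (hg : g.Monic) :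
    (∀ j < g.natDegree, g.coeff j ∈ Ideal.span {(p : ℤ_[p])}) ↔ Dist p g := by
  constructor
  · intro h
    refine ⟨hg, ?_⟩
    ext j
    rw [Polynomial.coeff_map, Polynomial.coeff_X_pow]
    rcases lt_trichotomy j g.natDegree with hj | hj | hj
    · rw [if_neg hj.ne, toZMod_eq_zero_iff]; exact h j hj
    · rw [if_pos hj, hj, hg.coeff_natDegree, map_one]
    · rw [if_neg hj.ne', Polynomial.coeff_eq_zero_of_natDegree_lt hj, map_zero]
  · rintro ⟨_, h⟩ j hj
    rw [← toZMod_eq_zero_iff, ← Polynomial.coeff_map, h, Polynomial.coeff_X_pow, if_neg hj.ne]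

variable {p}

lemma Dist.red {g : Polynomial ℤ_[p]} (hg : Dist p g) :
    red p (g : PowerSeries ℤ_[p]) = PowerSeries.X ^ g.natDegree := by
  have := hg.2
  rw [Iwa10.red, ← Polynomial.polynomial_map_coe, this]
  simp

lemma Dist.left {f h : Polynomial ℤ_[p]} (hf : f.Monic) (hg : Dist p (f * h)) : Dist p f := by
  refine ⟨hf, ?_⟩
  have h1 : f.map PadicInt.toZMod ∣ (Polynomial.X : Polynomial (ZMod p)) ^ (f * h).natDegree := by
    rw [← hg.2, Polynomial.map_mul]
    exact dvd_mul_right _ _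
  obtain ⟨i, _, hi⟩ := (dvd_prime_pow Polynomial.prime_X _).1 h1
  have := Polynomial.eq_of_monic_of_associated (hf.map _) (Polynomial.monic_X_pow i) hi
  have h2 := congrArg Polynomial.natDegree this
  rw [hf.natDegree_map, Polynomial.natDegree_X_pow] at h2
  rw [this, h2]

lemma Dist.ne_zero {g : Polynomial ℤ_[p]} (hg : Dist p g) : (g : PowerSeries ℤ_[p]) ≠ 0 := by
  intro h
  exact not_p_dvd p hg.red (h ▸ dvd_zero _)

lemma Dist.reg_p {g : Polynomial ℤ_[p]} (hg : Dist p g) :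
    Reg (g : PowerSeries ℤ_[p]) (p : PowerSeries ℤ_[p]) :=
  (Iwa10.reg_p p hg.red).symm (p_ne_zero p)

lemma Dist.cc_nu {q : Polynomial ℤ_[p]} (hq : Dist p q) (n : ℕ)
    (hd : q.natDegree < p ^ (n + 1) - p ^ n) :
    cc (q : PowerSeries ℤ_[p]) (nu p n) = p ^ q.natDegree := by
  obtain ⟨s, hs⟩ := red_eq_X_pow p hq.red
  obtain ⟨h, hh⟩ := red_eq_X_pow p (red_nu p n)
  set D := p ^ (n + 1) - p ^ n
  set d := q.natDegree
  have hD : D - d ≠ 0 := by omega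
  have h0 : PowerSeries.constantCoeff h = 1 := by
    have := congrArg PowerSeries.constantCoeff hh
    rw [constantCoeff_nu] at this
    simp only [map_add, map_pow, map_mul, PowerSeries.constantCoeff_X, map_natCast] at this
    rw [zero_pow (by omega), zero_add] at this
    have hp0 : (p : ℤ_[p]) ≠ 0 := by exact_mod_cast hp.out.ne_zero
    exact mul_left_cancel₀ hp0 (by rw [mul_one]; exact this.symm)
  have hw : IsUnit (h - PowerSeries.X ^ (D - d) * s) := by
    rw [PowerSeries.isUnit_iff_constantCoeff]
    simp [h0, hD]
  obtain ⟨w, hw⟩ := hw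
  have key : nu p n = (w : PowerSeries ℤ_[p]) * (p : PowerSeries ℤ_[p]) + PowerSeries.X ^ (D - d) * (q : PowerSeries ℤ_[p]) := by
    have : (PowerSeries.X : PowerSeries ℤ_[p]) ^ D = PowerSeries.X ^ (D - d) * PowerSeries.X ^ d := by
      rw [← pow_add]; congr 1; omega
    rw [hw, hs, hh, this]; ring
  calc cc (q : PowerSeries ℤ_[p]) (nu p n) = cc (q : PowerSeries ℤ_[p]) (w * (p : PowerSeries ℤ_[p])) := by
        rw [key, cc, cc, ← Ideal.span_union, ← Ideal.span_union]
        simp only [Set.singleton_union]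
        rw [Ideal.span_pair_add_mul_left]
    _ = p ^ d := by rw [cc_unit, cc_comm, cc_p p hq.red]

/-- the polynomial version of `ω_n` -/
noncomputable def omegaPoly (p : ℕ) [Fact p.Prime] (n : ℕ) : Polynomial ℤ_[p] :=
  (1 + Polynomial.X) ^ p ^ n - 1

lemma coe_omegaPoly (n : ℕ) : (omegaPoly p n : PowerSeries ℤ_[p]) = omegaPS10 p n := by
  simp [omegaPoly, omegaPS10]

lemma exists_pow_mem {q W : Polynomial ℤ_[p]} (hq : Irreducible q) (hm : q.Monic)
    (hW : ¬ q ∣ W) : ∃ (k : ℕ) (a b : Polynomial ℤ_[p]), a * q + b * W = (p : Polynomial ℤ_[p]) ^ k := by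
  have := AdjoinRoot.isDomain_of_prime hq.prime
  have hW0 : AdjoinRoot.mk q W ≠ 0 := by rwa [Ne, AdjoinRoot.mk_eq_zero]
  have : Module.Finite ℤ_[p] (AdjoinRoot q) := hm.finite_adjoinRoot
  have hne := Ideal.comap_ne_bot_of_integral_mem (R := ℤ_[p]) (I := Ideal.span {AdjoinRoot.mk q W}) hW0
    (Ideal.mem_span_singleton_self _) (Algebra.IsIntegral.isIntegral _)
  obtain ⟨c, hc, hc0⟩ := Submodule.exists_mem_ne_zero_of_ne_bot hne
  rw [Ideal.mem_comap, Ideal.mem_span_singleton] at hc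
  obtain ⟨b, hb⟩ := hc
  obtain ⟨b, rfl⟩ := AdjoinRoot.mk_surjective b
  rw [AdjoinRoot.algebraMap_eq, ← AdjoinRoot.mk_C, ← map_mul, ← sub_eq_zero, ← map_sub,
    AdjoinRoot.mk_eq_zero] at hb
  obtain ⟨a, ha⟩ := hb
  have hcs := PadicInt.unitCoeff_spec hc0
  set k := c.valuation
  set v := PadicInt.unitCoeff hc0
  have hv : Polynomial.C ((v⁻¹ : ℤ_[p]ˣ) : ℤ_[p]) * Polynomial.C c = (p : Polynomial ℤ_[p]) ^ k := by
    rw [← Polynomial.C_mul]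
    rw [hcs, Units.inv_mul_cancel_left]
    simp
  refine ⟨k, Polynomial.C ((v⁻¹ : ℤ_[p]ˣ) : ℤ_[p]) * a, Polynomial.C ((v⁻¹ : ℤ_[p]ˣ) : ℤ_[p]) * b, ?_⟩
  rw [← hv]
  linear_combination (-Polynomial.C ((v⁻¹ : ℤ_[p]ˣ) : ℤ_[p])) * ha

lemma Dist.irred {q : Polynomial ℤ_[p]} (hd : Dist p q) (hq : Irreducible q) {W : Polynomial ℤ_[p]}
    (hW : ¬ q ∣ W) : Reg (q : PowerSeries ℤ_[p]) W ∧ cc (q : PowerSeries ℤ_[p]) W ≠ 0 := by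
  obtain ⟨k, a, b, h⟩ := exists_pow_mem hq hd.1 hW
  have h' : (a : PowerSeries ℤ_[p]) * q + b * W = (p : PowerSeries ℤ_[p]) ^ k := by
    have := congrArg (fun f : Polynomial ℤ_[p] => (f : PowerSeries ℤ_[p])) h
    have hpp : ((p : Polynomial ℤ_[p]) : PowerSeries ℤ_[p]) = p :=
      map_natCast (Polynomial.coeToPowerSeries.ringHom (R := ℤ_[p])) p
    simpa [hpp] using this
  constructor
  · intro x hx
    apply hd.reg_p.pow k
    rw [← h', add_mul]
    refine dvd_add ⟨a * x, by ring⟩ ?_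
    rw [mul_assoc]
    exact hx.mul_left _
  · have h1 : cc (q : PowerSeries ℤ_[p]) ((p : PowerSeries ℤ_[p]) ^ k) ≠ 0 := by
      rw [hd.reg_p.cc_pow, cc_comm, cc_p p hd.red]
      exact pow_ne_zero _ (pow_ne_zero _ hp.out.ne_zero)
    refine fun h0 => h1 ?_
    rw [cc] at h0 ⊢
    refine Nat.eq_zero_of_zero_dvd (h0 ▸ AddSubgroup.index_dvd_of_le ?_)
    rw [Submodule.toAddSubgroup_le]
    refine sup_le le_sup_left ?_
    rw [Ideal.span_singleton_le_iff_mem, ← h']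
    exact add_mem (Ideal.mul_mem_left _ _ (Ideal.mem_sup_left (Ideal.mem_span_singleton_self _)))
      (Ideal.mul_mem_left _ _ (Ideal.mem_sup_right (Ideal.mem_span_singleton_self _)))

end padic

section final
variable {p : ℕ} [hp : Fact p.Prime]

lemma main_dist (P : PowerSeries ℤ_[p])
    (hcop : ∀ m : ℕ, 1 ≤ m → ∀ q : PowerSeries ℤ_[p], Irreducible q →
        q ∣ P → ¬ q ∣ omegaPS10 p m)
    (n₀ : ℕ)
    (hsmall : ∀ q : Polynomial ℤ_[p], Irreducible q → q.Monic →
        (∀ j < q.natDegree, q.coeff j ∈ Ideal.span {(p : ℤ_[p])}) →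
        ((q : Polynomial ℤ_[p]) : PowerSeries ℤ_[p]) ∣ P →
        q.natDegree < p ^ (n₀ - 1) * (p - 1)) (n : ℕ) (hn : 1 ≤ n) (N : ℕ) :
    ∀ g : Polynomial ℤ_[p], Dist p g → g.natDegree = N → (g : PowerSeries ℤ_[p]) ∣ P →
      Reg (g : PowerSeries ℤ_[p]) (omegaPS10 p n) ∧ cc (g : PowerSeries ℤ_[p]) (omegaPS10 p n) ≠ 0 ∧
      (n₀ ≤ n → Reg (g : PowerSeries ℤ_[p]) (nu p n) ∧
        cc (g : PowerSeries ℤ_[p]) (nu p n) = p ^ g.natDegree) := by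
  induction N using Nat.strong_induction_on with
  | _ N ih =>
  intro g hg hN hgP
  by_cases hg1 : g = 1
  · subst hg1
    have h1 : ((1 : Polynomial ℤ_[p]) : PowerSeries ℤ_[p]) = ((1 : (PowerSeries ℤ_[p])ˣ) : PowerSeries ℤ_[p]) := by simp
    have h2 : ∀ a, cc ((1 : Polynomial ℤ_[p]) : PowerSeries ℤ_[p]) a = 1 := by
      intro a
      rw [cc_comm, h1, Units.val_one, cc_one]
    rw [h2, h2, h1]
    exact ⟨reg_unit _ _, one_ne_zero, fun _ => ⟨reg_unit _ _, by simp⟩⟩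
  by_cases hirr : Irreducible g
  · have hnd : ∀ m, 1 ≤ m → ¬ g ∣ omegaPoly p m := by
      intro m hm hdvd
      have hnu : ¬ IsUnit (g : PowerSeries ℤ_[p]) := by
        intro hu
        have := hu.map (red p)
        rw [hg.red, isUnit_pow_iff, PowerSeries.isUnit_iff_constantCoeff] at this
        · simp at this
        · intro h0
          exact hg1 (hg.1.natDegree_eq_zero.1 h0)
      obtain ⟨q, hq, hqg⟩ := WfDvdMonoid.exists_irreducible_factor hnu hg.ne_zero
      refine hcop m hm q hq (hqg.trans hgP) (hqg.trans ?_)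
      rw [← coe_omegaPoly]
      obtain ⟨c, hc⟩ := hdvd
      exact ⟨c, by rw [hc, Polynomial.coe_mul]⟩
    have h1 := hg.irred hirr (hnd n hn)
    have h2 := hg.irred hirr (hnd (n + 1) (by omega))
    rw [coe_omegaPoly] at h1 h2
    refine ⟨h1.1, h1.2, fun hn0 => ⟨?_, hg.cc_nu n ?_⟩⟩
    · rw [omega_succ] at h2
      exact h2.1.of_mul_right
    · refine (hsmall g hirr hg.1 ((dist_iff p hg.1).2 hg) hgP).trans_le ?_
      calc p ^ (n₀ - 1) * (p - 1) ≤ p ^ n * (p - 1) :=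
            Nat.mul_le_mul_right _ (Nat.pow_le_pow_right hp.out.pos (by omega))
        _ = p ^ (n + 1) - p ^ n := by rw [Nat.mul_sub, mul_one, pow_succ]
  · rw [hg.1.irreducible_iff_natDegree] at hirr
    push Not at hirr
    obtain ⟨f, h, hf, hh, rfl, hf0, hh0⟩ := hirr hg1
    have hdeg := hf.natDegree_mul hh
    have df : Dist p f := Dist.left hf hg
    have dh : Dist p h := Dist.left hh (by rwa [mul_comm] at hg)
    rw [Polynomial.coe_mul] at hgP ⊢
    obtain ⟨f1, f2, f3⟩ := ih f.natDegree (by omega) f df rfl ((dvd_mul_right _ _).trans hgP)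
    obtain ⟨h1, h2, h3⟩ := ih h.natDegree (by omega) h dh rfl ((dvd_mul_left _ _).trans hgP)
    refine ⟨f1.mul h1 df.ne_zero, ?_, fun hn0 => ⟨(f3 hn0).1.mul (h3 hn0).1 df.ne_zero, ?_⟩⟩
    · rw [f1.mul_cc df.ne_zero]
      exact mul_ne_zero f2 h2
    · rw [(f3 hn0).1.mul_cc df.ne_zero, (f3 hn0).2, (h3 hn0).2, hdeg, pow_add]

lemma main_F (P : PowerSeries ℤ_[p])
    (hcop : ∀ m : ℕ, 1 ≤ m → ∀ q : PowerSeries ℤ_[p], Irreducible q →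
        q ∣ P → ¬ q ∣ omegaPS10 p m)
    (n₀ : ℕ)
    (hsmall : ∀ q : Polynomial ℤ_[p], Irreducible q → q.Monic →
        (∀ j < q.natDegree, q.coeff j ∈ Ideal.span {(p : ℤ_[p])}) →
        ((q : Polynomial ℤ_[p]) : PowerSeries ℤ_[p]) ∣ P →
        q.natDegree < p ^ (n₀ - 1) * (p - 1)) (n : ℕ) (hn : 1 ≤ n)
    (g : Polynomial ℤ_[p]) (hg : Dist p g) (u : (PowerSeries ℤ_[p])ˣ) (μ : ℕ)
    (F : PowerSeries ℤ_[p]) (hF : F = u * (p : PowerSeries ℤ_[p]) ^ μ * g) (hFP : F ∣ P) :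
    Reg F (omegaPS10 p n) ∧ cc F (omegaPS10 p n) ≠ 0 ∧
      (n₀ ≤ n → cc F (omegaPS10 p (n + 1)) =
        cc F (omegaPS10 p n) * p ^ (μ * (p ^ (n + 1) - p ^ n) + g.natDegree)) := by
  obtain ⟨g1, g2, g3⟩ := main_dist P hcop n₀ hsmall n hn _ g hg rfl
    ((Dvd.intro_left _ hF.symm).trans hFP)
  have hp0 := p_ne_zero p
  have hpμ : (p : PowerSeries ℤ_[p]) ^ μ ≠ 0 := pow_ne_zero _ hp0
  have key : ∀ a, Reg (p : PowerSeries ℤ_[p]) a → Reg (g : PowerSeries ℤ_[p]) a →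
      Reg F a ∧ cc F a = cc (p : PowerSeries ℤ_[p]) a ^ μ * cc (g : PowerSeries ℤ_[p]) a := by
    intro a ha hga
    constructor
    · rw [hF, mul_assoc]
      exact (reg_unit u a).mul ((ha.pow_left hp0 μ).mul hga hpμ) u.ne_zero
    · rw [hF, mul_assoc, cc_comm, cc_unit, cc_comm, (ha.pow_left hp0 μ).mul_cc hpμ, ha.pow_cc hp0]
  have ko := key _ (reg_p p (red_omega p n)) g1
  refine ⟨ko.1, ?_, fun hn0 => ?_⟩
  · rw [ko.2, cc_p p (red_omega p n)]
    exact mul_ne_zero (pow_ne_zero _ (pow_ne_zero _ hp.out.ne_zero)) g2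
  · have kn := key _ (reg_p p (red_nu p n)) (g3 hn0).1
    rw [omega_succ, ko.1.cc_mul, kn.2, (g3 hn0).2, cc_p p (red_nu p n), ← pow_mul, ← pow_add,
      mul_comm μ]

end final

end Iwa10

open Iwa10 in
/-- Let `M` be a finitely generated torsion `Λ = Zp[[X]]`-module whose
characteristic ideal (generated by `F = ∏ Fᵢ`, realized by an injection
`M/M′ ↪ ⊕ᵢ Λ/(Fᵢ)` with finite cokernel, where `Fᵢ = uᵢ·p^{μᵢ}·gᵢ` by Weierstrass with
`gᵢ` distinguished of degree `λᵢ`) is coprime to `ω_m` for all `m ≥ 1`.  If every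
irreducible distinguished polynomial dividing `F` has degree `< p^{n₀-1}(p-1)`, then for
all `n ≥ n₀`: `e(M/ω_n M) − e(M/ω_{n₀} M) = μ(M)(p^n − p^{n₀}) + λ(M)(n − n₀)
+ e(M′/ω_n M′) − e(M′/ω_{n₀} M′)`, where `μ(M) = Σ μᵢ`, `λ(M) = Σ λᵢ`, `M′` is the
maximal finite submodule, and `e` is the `p`-exponent of the cardinality (stated
additively to avoid truncated subtraction). -/
theorem stmt10 (p : ℕ) [hp : Fact p.Prime]
    (M : Type*) [AddCommGroup M] [Module (PowerSeries ℤ_[p]) M]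
    [Module.Finite (PowerSeries ℤ_[p]) M]
    (htors : Module.IsTorsion (PowerSeries ℤ_[p]) M)
    (M' : Submodule (PowerSeries ℤ_[p]) M) (hM'fin : Finite M')
    (hM'max : ∀ N : Submodule (PowerSeries ℤ_[p]) M, Finite N → N ≤ M')
    (r : ℕ) (Fs : Fin r → PowerSeries ℤ_[p])
    (u : Fin r → (PowerSeries ℤ_[p])ˣ) (μi lami : Fin r → ℕ)
    (g : Fin r → Polynomial ℤ_[p])
    (hmonic : ∀ i, (g i).Monic) (hdeg : ∀ i, (g i).natDegree = lami i)
    (hdist : ∀ i, ∀ j < lami i, (g i).coeff j ∈ Ideal.span {(p : ℤ_[p])})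
    (hFs : ∀ i, Fs i = (u i : PowerSeries ℤ_[p]) * (p : PowerSeries ℤ_[p]) ^ μi i *
        ((g i : Polynomial ℤ_[p]) : PowerSeries ℤ_[p]))
    (φ : (M ⧸ M') →ₗ[PowerSeries ℤ_[p]]
        (∀ i : Fin r, PowerSeries ℤ_[p] ⧸ Ideal.span {Fs i}))
    (hinj : Function.Injective φ)
    (hcoker : Finite
        ((∀ i : Fin r, PowerSeries ℤ_[p] ⧸ Ideal.span {Fs i}) ⧸ LinearMap.range φ))
    (hcop : ∀ m : ℕ, 1 ≤ m → ∀ q : PowerSeries ℤ_[p], Irreducible q →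
        q ∣ ∏ i, Fs i → ¬ q ∣ omegaPS10 p m)
    (n₀ : ℕ) (hn₀ : 1 ≤ n₀)
    (hsmall : ∀ q : Polynomial ℤ_[p], Irreducible q → q.Monic →
        (∀ j < q.natDegree, q.coeff j ∈ Ideal.span {(p : ℤ_[p])}) →
        ((q : Polynomial ℤ_[p]) : PowerSeries ℤ_[p]) ∣ ∏ i, Fs i →
        q.natDegree < p ^ (n₀ - 1) * (p - 1)) :
    ∀ n : ℕ, n₀ ≤ n →
      Finite (M ⧸ (Ideal.span {omegaPS10 p n} • ⊤ : Submodule (PowerSeries ℤ_[p]) M)) ∧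
      Finite (M' ⧸ (Ideal.span {omegaPS10 p n} • ⊤ : Submodule (PowerSeries ℤ_[p]) M')) ∧
      (Nat.card (M ⧸ (Ideal.span {omegaPS10 p n} • ⊤ :
            Submodule (PowerSeries ℤ_[p]) M))).factorization p
        + (Nat.card (M' ⧸ (Ideal.span {omegaPS10 p n₀} • ⊤ :
            Submodule (PowerSeries ℤ_[p]) M'))).factorization p
        + (∑ i, μi i) * p ^ n₀ + (∑ i, lami i) * n₀ =
      (Nat.card (M ⧸ (Ideal.span {omegaPS10 p n₀} • ⊤ :
            Submodule (PowerSeries ℤ_[p]) M))).factorization p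
        + (Nat.card (M' ⧸ (Ideal.span {omegaPS10 p n} • ⊤ :
            Submodule (PowerSeries ℤ_[p]) M'))).factorization p
        + (∑ i, μi i) * p ^ n + (∑ i, lami i) * n := by

  have hD : ∀ i, Dist p (g i) := fun i =>
    (dist_iff p (hmonic i)).1 (by rw [hdeg i]; exact hdist i)
  have hF := fun (n : ℕ) (hn : 1 ≤ n) (i : Fin r) => main_F (∏ i, Fs i) hcop n₀ hsmall n hn (g i)
    (hD i) (u i) (μi i) (Fs i) (hFs i) (Finset.dvd_prod_of_mem Fs (Finset.mem_univ i))
  have hM : ∀ n, 1 ≤ n → ix (omegaPS10 p n) M =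
      ix (omegaPS10 p n) M' * ∏ i, cc (Fs i) (omegaPS10 p n) := fun n hn =>
    ix_main _ M' Fs φ hinj hcoker (fun i => (hF n hn i).1)
  have hfq : ∀ n, Finite (M' ⧸ (Ideal.span {omegaPS10 p n} • ⊤ :
      Submodule (PowerSeries ℤ_[p]) M')) := fun n =>
    Finite.of_surjective _ (Submodule.mkQ_surjective _)
  have hM'0 : ∀ n, ix (omegaPS10 p n) M' ≠ 0 := fun n => by
    rw [← card_eq_ix]
    have := hfq n
    exact Nat.card_pos.ne'
  have hP0 : ∀ n, 1 ≤ n → ∏ i, cc (Fs i) (omegaPS10 p n) ≠ 0 := fun n hn =>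
    Finset.prod_ne_zero_iff.2 fun i _ => (hF n hn i).2.1
  have hfac : ∀ n, 1 ≤ n → (ix (omegaPS10 p n) M).factorization p =
      (ix (omegaPS10 p n) M').factorization p +
        (∏ i, cc (Fs i) (omegaPS10 p n)).factorization p := fun n hn => by
    rw [hM n hn, Nat.factorization_mul (hM'0 n) (hP0 n hn)]; rfl
  have hstep : ∀ n, n₀ ≤ n → (∏ i, cc (Fs i) (omegaPS10 p n)).factorization p
      + (∑ i, μi i) * p ^ n₀ + (∑ i, lami i) * n₀ =
      (∏ i, cc (Fs i) (omegaPS10 p n₀)).factorization p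
      + (∑ i, μi i) * p ^ n + (∑ i, lami i) * n := by
    intro n hn
    induction n, hn using Nat.le_induction with
    | base => rfl
    | succ n hn ih =>
      have h1 : ∏ i, cc (Fs i) (omegaPS10 p (n + 1)) = (∏ i, cc (Fs i) (omegaPS10 p n)) *
          p ^ ((∑ i, μi i) * (p ^ (n + 1) - p ^ n) + ∑ i, lami i) := by
        rw [Finset.prod_congr rfl fun i _ => (hF n (hn₀.trans hn) i).2.2 hn,
          Finset.prod_mul_distrib, Finset.prod_pow_eq_pow_sum, Finset.sum_add_distrib,
          Finset.sum_mul]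
        simp_rw [hdeg]
      rw [h1, Nat.factorization_mul (hP0 n (hn₀.trans hn)) (pow_ne_zero _ hp.out.ne_zero),
        Finsupp.add_apply, hp.out.factorization_pow, Finsupp.single_eq_same]
      obtain ⟨D, hD⟩ := Nat.exists_eq_add_of_le
        (Nat.pow_le_pow_right hp.out.pos (Nat.le_succ n) : p ^ n ≤ p ^ (n + 1))
      rw [hD, Nat.add_sub_cancel_left]
      linear_combination ih
  intro n hn
  have hn1 := hn₀.trans hn
  refine ⟨?_, hfq n, ?_⟩
  · apply Nat.finite_of_card_ne_zero
    rw [card_eq_ix, hM n hn1]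
    exact mul_ne_zero (hM'0 n) (hP0 n hn1)
  · simp only [card_eq_ix]
    rw [hfac n hn1, hfac n₀ hn₀]
    linear_combination hstep n hn
end
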